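/- For every natural number n with n ≥ 9, p(n) ≤ a(n), where p(n) is the number of partitions of n and a(n) is the number of isomorphism classes of Anosov graphs on n vertices. -/

import Mathlib

/-- x ∼ y iff the open neighborhoods coincide or the closed neighborhoods coincide. -/
def simRel {V : Type*} (G : SimpleGraph V) (x y : V) : Prop :=
  G.neighborSet x = G.neighborSet y ∨
    insert x (G.neighborSet x) = insert y (G.neighborSet y)

/-- A connected simple graph is Anosov if every ∼-class has at least two vertices and every
∼-class with exactly two vertices is edgeless. -/
def IsAnosov {V : Type*} (G : SimpleGraph V) : Prop :=
  G.Connected ∧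
    (∀ x : V, 2 ≤ {y | simRel G x y}.ncard) ∧
    (∀ x y : V, {z | simRel G x z}.ncard = 2 → simRel G x y → ¬ G.Adj x y)

/-- Graphs on `Fin n` satisfying a property `P`, up to isomorphism. -/
def graphClassSetoid (n : ℕ) (P : SimpleGraph (Fin n) → Prop) :
    Setoid {G : SimpleGraph (Fin n) // P G} where
  r G H := Nonempty (G.1 ≃g H.1)
  iseqv := ⟨fun _ => ⟨RelIso.refl _⟩, fun ⟨e⟩ => ⟨e.symm⟩, fun ⟨e⟩ ⟨f⟩ => ⟨e.trans f⟩⟩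

/-- `a n`: the number of isomorphism classes of Anosov graphs on `n` vertices. -/
noncomputable def anosovCount (n : ℕ) : ℕ :=
  Nat.card (Quotient (graphClassSetoid n IsAnosov))

/-- Graph coloured by classes: adjacency depends only on colours. -/
def cgraph {W C : Type*} (R : C → C → Prop) (hR : ∀ a b, R a b → R b a) (c : W → C) :
    SimpleGraph W where
  Adj x y := x ≠ y ∧ R (c x) (c y)
  symm := ⟨fun _ _ h => ⟨h.1.symm, hR _ _ h.2⟩⟩
  loopless := ⟨fun _ h => h.1 rfl⟩

section general
variable {W C : Type*} [Finite W] (R : C → C → Prop) (hR : ∀ a b, R a b → R b a) (c : W → C)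

theorem cgraph_sim {x y : W} (h : c x = c y) : simRel (cgraph R hR c) x y := by
  by_cases hr : R (c x) (c x)
  · right
    ext z
    simp only [Set.mem_insert_iff, SimpleGraph.mem_neighborSet, cgraph]
    rw [← h]
    by_cases hx : z = x
    · subst hx; simp; by_cases hy : z = y
      · simp [hy]
      · right; exact ⟨fun h => hy h.symm, hr⟩
    · by_cases hy : z = y
      · subst hy; simp [hx]; exact ⟨fun h => hx h.symm, by rw [← h]; exact hr⟩
      · simp [hx, hy, Ne.symm hx, Ne.symm hy]
  · left
    ext z
    simp only [SimpleGraph.mem_neighborSet, cgraph]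
    constructor
    · rintro ⟨_, h2⟩
      refine ⟨?_, by rwa [← h]⟩
      rintro rfl
      rw [← h] at h2; exact hr h2
    · rintro ⟨_, h2⟩
      rw [← h] at h2
      refine ⟨?_, h2⟩
      rintro rfl
      exact hr h2

theorem cgraph_anosov (hconn : (cgraph R hR c).Connected)
    (h2 : ∀ x, 2 ≤ {y | c y = c x}.ncard)
    (h3 : ∀ x, R (c x) (c x) → 3 ≤ {y | c y = c x}.ncard) : IsAnosov (cgraph R hR c) := by
  have hsub : ∀ x, {y | c y = c x} ⊆ {y | simRel (cgraph R hR c) x y} := by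
    intro x y hy
    exact cgraph_sim R hR c (Eq.symm hy)
  refine ⟨hconn, fun x => (h2 x).trans (Set.ncard_le_ncard (hsub x) (Set.toFinite _)), ?_⟩
  intro x y hc hs ha
  have hle := Set.ncard_le_ncard (hsub x) (Set.toFinite _)
  by_cases hr : R (c x) (c x)
  · have := h3 x hr
    omega
  · have he := Set.eq_of_subset_of_ncard_le (hsub x) (by rw [hc]; exact h2 x) (Set.toFinite _)
    have hy : y ∈ {y | c y = c x} := by rw [he]; exact hs
    have hy' : c y = c x := hy
    have := ha.2
    rw [hy'] at this
    exact hr this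

theorem exists_other (h2 : ∀ x, 2 ≤ {y | c y = c x}.ncard) (x : W) : ∃ y, y ≠ x ∧ c y = c x := by
  have := h2 x
  obtain ⟨y, hy, hne⟩ := Set.exists_ne_of_one_lt_ncard (show 1 < {y | c y = c x}.ncard by omega) x
  exact ⟨y, hne, hy⟩

end general

/-- v has a closed twin -/
def ctwin {W : Type*} (G : SimpleGraph W) (v : W) : Prop :=
  ∃ w, w ≠ v ∧ ∀ x, (x = v ∨ G.Adj v x) ↔ (x = w ∨ G.Adj w x)

/-- v lies in a dominating independent class of size s -/
def domc {W : Type*} (G : SimpleGraph W) (s : ℕ) (v : W) : Prop :=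
  {y | ¬ G.Adj v y}.ncard = s ∧ ∀ w, ¬ G.Adj v w → ∀ x, G.Adj v x ↔ G.Adj w x

/-- number of vertices with a closed twin -/
noncomputable def invT {W : Type*} (G : SimpleGraph W) : ℕ := Nat.card {v // ctwin G v}
/-- number of vertices in dominating independent classes of size s -/
noncomputable def invD {W : Type*} (G : SimpleGraph W) (s : ℕ) : ℕ := Nat.card {v // domc G s v}

theorem invT_iso {W W' : Type*} {G : SimpleGraph W} {H : SimpleGraph W'} (e : G ≃g H) :
    invT G = invT H := by
  refine Nat.card_congr (Equiv.subtypeEquiv e.toEquiv fun v => ?_)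
  have ha : ∀ x y, H.Adj (e x) (e y) ↔ G.Adj x y := fun x y => e.map_adj_iff
  have he : ∀ x y, e x = e y ↔ x = y := fun x y => e.injective.eq_iff
  change ctwin G v ↔ ctwin H (e v)
  unfold ctwin
  rw [e.surjective.exists]
  refine exists_congr fun w => ?_
  rw [e.surjective.forall]
  simp only [ha, he, ne_eq]

theorem invD_iso {W W' : Type*} {G : SimpleGraph W} {H : SimpleGraph W'} (e : G ≃g H) (s : ℕ) :
    invD G s = invD H s := by
  refine Nat.card_congr (Equiv.subtypeEquiv e.toEquiv fun v => ?_)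
  have ha : ∀ x y, H.Adj (e x) (e y) ↔ G.Adj x y := fun x y => e.map_adj_iff
  change domc G s v ↔ domc H s (e v)
  unfold domc
  have h1 : {y | ¬ H.Adj (e v) y} = e '' {y | ¬ G.Adj v y} := by
    ext y
    obtain ⟨y, rfl⟩ := e.surjective y
    simp [ha]
  rw [h1, Set.ncard_image_of_injective _ e.injective]
  refine and_congr Iff.rfl ?_
  rw [e.surjective.forall]
  refine forall_congr' fun w => ?_
  rw [e.surjective.forall]
  simp only [ha]

theorem connected_of_center {W : Type*} (G : SimpleGraph W) (u w : W) (h : u = w ∨ G.Adj u w)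
    (hx : ∀ x, x = u ∨ x = w ∨ G.Adj x u ∨ G.Adj x w) : G.Connected := by
  have huw : G.Reachable w u := by
    rcases h with rfl | h
    · exact SimpleGraph.Reachable.refl _
    · exact h.symm.reachable
  have key : ∀ x, G.Reachable x u := by
    intro x
    rcases hx x with rfl | rfl | h | h
    · exact SimpleGraph.Reachable.refl _
    · exact huw
    · exact h.reachable
    · exact h.reachable.trans huw
  have : Nonempty W := ⟨u⟩
  exact ⟨fun x y => (key x).trans (key y).symm⟩

/-- The colour relation. Colours 0,1,2 on the left, dominating independent classes on the right. -/
def colR (t : Prop) {P : Type*} : Fin 3 ⊕ P → Fin 3 ⊕ P → Prop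
  | .inr p, .inr q => p ≠ q
  | .inr _, .inl _ => True
  | .inl _, .inr _ => True
  | .inl i, .inl j => i = 2 ∨ j = 2 ∨ (i = 0 ∧ j = 0) ∨ (i = 1 ∧ j = 1 ∧ t)

theorem colR_symm (t : Prop) {P : Type*} (a b : Fin 3 ⊕ P) (h : colR t a b) : colR t b a := by
  rcases a with i | p <;> rcases b with j | q <;> simp_all [colR]
  · tauto
  · exact fun h' => h h'.symm

/-- sizes of the colour classes -/
def colSize (k l m : ℕ) (μ : Multiset ℕ) : Fin 3 ⊕ μ.ToType → ℕ
  | .inr p => p.1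
  | .inl i => if i = 0 then k else if i = 1 then l else m

theorem colSize_sum (k l m : ℕ) (μ : Multiset ℕ) :
    ∑ x, colSize k l m μ x = k + l + m + μ.sum := by
  rw [Fintype.sum_sum_type]
  congr 1
  · simp [Fin.sum_univ_three, colSize]
  · simp only [colSize]
    rw [← Multiset.sum_eq_sum_coe]

theorem exists_colouring {C : Type*} [Fintype C] (sz : C → ℕ) (n : ℕ) (h : ∑ x, sz x = n) :
    ∃ c : Fin n → C, ∀ S : C → Prop, ∀ [DecidablePred S],
      Nat.card {x // S (c x)} = ∑ x, if S x then sz x else 0 := by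
  have hc : Fintype.card (Σ x : C, Fin (sz x)) = n := by simp [h]
  let e : Fin n ≃ (Σ x : C, Fin (sz x)) := (Fintype.equivFinOfCardEq hc).symm
  refine ⟨fun x => (e x).1, fun S _ => ?_⟩
  have e1 : {x // S (e x).1} ≃ {y : (Σ x : C, Fin (sz x)) // S y.1} :=
    Equiv.subtypeEquiv e (fun _ => Iff.rfl)
  rw [Nat.card_congr e1, Nat.card_eq_fintype_card]
  have e2 : {y : (Σ x : C, Fin (sz x)) // S y.1} ≃ (Σ x : C, {a : Fin (sz x) // S x}) :=
    { toFun := fun y => ⟨y.1.1, y.1.2, y.2⟩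
      invFun := fun y => ⟨⟨y.1, y.2.1⟩, y.2.2⟩
      left_inv := fun _ => rfl
      right_inv := fun _ => rfl }
  rw [Fintype.card_congr e2, Fintype.card_sigma]
  refine Finset.sum_congr rfl fun x _ => ?_
  by_cases hs : S x <;> simp [hs, Fintype.card_subtype]

theorem realize (n k l m : ℕ) (t : Prop) [Decidable t] (μ : Multiset ℕ)
    (hn : k + l + m + μ.sum = n)
    (hkl : (k = 0 ∧ l = 0) ∨ (3 ≤ k ∧ 2 ≤ l ∧ (t → 3 ≤ l)))
    (hm : m = 0 ∨ 3 ≤ m) (hμ : ∀ x ∈ μ, 2 ≤ x)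
    (hconn : 1 ≤ m ∨ (μ ≠ 0 ∧ (1 ≤ k ∨ 2 ≤ μ.card))) :
    ∃ G : SimpleGraph (Fin n), IsAnosov G ∧ invT G = k + m + (if t then l else 0) ∧
      ∀ s, invD G s = s * μ.count s + if s = 1 then m else 0 := by
  classical
  obtain ⟨c, hc⟩ := exists_colouring (colSize k l m μ) n (by rw [colSize_sum, hn])
  have hfib : ∀ a, {y | c y = a}.ncard = colSize k l m μ a := by
    intro a
    have := hc (fun x => x = a)
    rw [← Nat.card_coe_set_eq]
    refine Eq.trans this ?_
    simp
  have hex : ∀ a, 0 < colSize k l m μ a → ∃ x, c x = a := by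
    intro a ha
    rw [← hfib a] at ha
    exact Set.nonempty_of_ncard_ne_zero ha.ne'
  have hpos : ∀ x, 0 < colSize k l m μ (c x) := by
    intro x
    rw [← hfib]
    exact (Set.ncard_pos (Set.toFinite _)).2 ⟨x, rfl⟩
  have hp2 : ∀ p : μ.ToType, 2 ≤ p.1 := fun p => hμ _ (Multiset.coe_mem)
  have h2 : ∀ x, 2 ≤ {y | c y = c x}.ncard := by
    intro x
    have := hpos x
    rw [hfib]
    rcases h : c x with i | p
    · rw [h] at this
      fin_cases i <;> simp [colSize] at this ⊢ <;> omega
    · exact hp2 p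
  have h3 : ∀ x, colR t (c x) (c x) → 3 ≤ {y | c y = c x}.ncard := by
    intro x
    have := hpos x
    rw [hfib]
    rcases h : c x with i | p
    · rw [h] at this
      fin_cases i <;> simp [colSize, colR] at this ⊢ <;> intros <;> simp_all <;> omega
    · intro hh; exact absurd rfl hh
  set G := cgraph (colR t) (colR_symm t) c with hG
  have hadj : ∀ x y, G.Adj x y ↔ x ≠ y ∧ colR t (c x) (c y) := fun _ _ => Iff.rfl
  have hother := exists_other c h2
  refine ⟨G, cgraph_anosov _ _ _ ?_ h2 h3, ?_, ?_⟩
  · -- connectivity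
    by_cases hm1 : 1 ≤ m
    · obtain ⟨u, hu⟩ := hex (.inl 2) (by simp [colSize]; omega)
      refine connected_of_center _ u u (Or.inl rfl) fun x => ?_
      by_cases hxu : x = u
      · exact Or.inl hxu
      · right; right; left
        refine ⟨hxu, ?_⟩
        rw [hu]
        rcases c x with i | p <;> simp [colR]
    · obtain ⟨hne, hk⟩ := hconn.resolve_left hm1
      obtain ⟨s, hs⟩ := Multiset.exists_mem_of_ne_zero hne
      have hcard : 0 < Fintype.card μ.ToType := by
        rw [Multiset.card_coe]; exact Multiset.card_pos.2 hne
      obtain ⟨p⟩ := Fintype.card_pos_iff.1 hcard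
      obtain ⟨u, hu⟩ := hex (.inr p) (by have := hp2 p; simp [colSize]; omega)
      have hw : ∃ w, c w ≠ .inr p := by
        rcases hk with hk | hk
        · obtain ⟨w, hw⟩ := hex (.inl 0) (by simp [colSize]; omega)
          exact ⟨w, by simp [hw]⟩
        · have : 1 < Fintype.card μ.ToType := by rw [Multiset.card_coe]; omega
          obtain ⟨q, hq⟩ := Fintype.exists_ne_of_one_lt_card this p
          obtain ⟨w, hw⟩ := hex (.inr q) (by have := hp2 q; simp [colSize]; omega)
          exact ⟨w, by simp [hw, hq]⟩
      obtain ⟨w, hw⟩ := hw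
      have hR1 : ∀ x, c x ≠ .inr p → colR t (c x) (.inr p) := by
        intro x hx
        rcases h : c x with i | q
        · simp [colR]
        · rw [h] at hx
          simpa [colR] using hx
      have hA : ∀ x y, c x ≠ .inr p → c y = .inr p → G.Adj x y := by
        intro x y hx hy
        refine ⟨?_, ?_⟩
        · rintro rfl; exact hx hy
        · rw [hy]; exact hR1 x hx
      refine connected_of_center _ u w (Or.inr (hA w u hw hu).symm) fun x => ?_
      by_cases hx : c x = .inr p
      · exact Or.inr (Or.inr (Or.inr (hA w x hw hx).symm))
      · exact Or.inr (Or.inr (Or.inl (hA x u hx hu)))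
  · have key : ∀ v, ctwin G v ↔ colR t (c v) (c v) := by
      intro v
      constructor
      · rintro ⟨w, hwv, h⟩
        by_contra hr
        obtain ⟨v', hv', hcv⟩ := hother v
        have h1 : G.Adj v w := ((h w).2 (Or.inl rfl)).resolve_left hwv
        have hv'w : v' ≠ w := by
          rintro rfl
          have := h1.2
          rw [hcv] at this; exact hr this
        have h2 : G.Adj w v' := ⟨hv'w.symm, by rw [hcv]; exact h1.symm.2⟩
        have h4 : G.Adj v v' := ((h v').2 (Or.inr h2)).resolve_left hv'
        have := h4.2
        rw [hcv] at this
        exact hr this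
      · intro hr
        obtain ⟨w, hw, hcw⟩ := hother v
        refine ⟨w, hw, fun x => ?_⟩
        simp only [hadj, hcw]
        by_cases hx : x = v
        · subst hx; simp [hw, hr]
        · by_cases hx' : x = w
          · subst hx'; simp [hcw, hr, Ne.symm hx]
          · simp [hx, hx', Ne.symm hx, Ne.symm hx']
    have e1 : invT G = Nat.card {x // colR t (c x) (c x)} :=
      Nat.card_congr (Equiv.subtypeEquivRight key)
    rw [e1, hc (fun a => colR t a a), Fintype.sum_sum_type]
    simp [Fin.sum_univ_three, colR, colSize]
    omega
  · intro s
    have key : ∀ v, domc G s v ↔ (c v = .inl 2 ∧ s = 1) ∨ (∃ p : μ.ToType, c v = .inr p ∧ p.1 = s) := by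
      intro v
      have hv := hpos v
      rcases h : c v with i | p
      · have h01 : (i = 0 ∨ i = 1) → ¬ domc G s v := by
          intro hi hd
          have hkl' : 3 ≤ k ∧ 2 ≤ l := by
            rw [h] at hv
            rcases hi with rfl | rfl <;> simp [colSize] at hv <;> omega
          obtain ⟨x0, hx0⟩ := hex (.inl 0) (by simp [colSize]; omega)
          obtain ⟨x1, hx1⟩ := hex (.inl 1) (by simp [colSize]; omega)
          have hn01 : ∀ x y, c x = .inl 0 → c y = .inl 1 → ¬ G.Adj x y := by
            intro x y hx hy hxy
            have := hxy.2
            rw [hx, hy] at this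
            simp [colR] at this
          have h00 : ∀ x y, c x = .inl 0 → c y = .inl 0 → x ≠ y → G.Adj x y := by
            intro x y hx hy hxy
            refine ⟨hxy, ?_⟩
            rw [hx, hy]; simp [colR]
          rcases hi with rfl | rfl
          · obtain ⟨v', hv', hcv⟩ := hother v
            have := (hd.2 x1 (hn01 _ _ h hx1) v').1 (h00 _ _ h (hcv.trans h) hv'.symm)
            exact hn01 v' x1 (hcv.trans h) hx1 this.symm
          · obtain ⟨v', hv', hcv⟩ := hother x0
            have := (hd.2 x0 (fun h' => hn01 _ _ hx0 h h'.symm) v').2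
              (h00 _ _ hx0 (hcv.trans hx0) hv'.symm)
            exact hn01 v' v (hcv.trans hx0) h this.symm
        fin_cases i
        · simpa using h01 (Or.inl rfl)
        · simpa using h01 (Or.inr rfl)
        · have hS : ∀ y, ¬ G.Adj v y ↔ y = v := by
            intro y
            rw [hadj, h]
            have : colR t (.inl 2) (c y) := by
              rcases c y with i | p <;> simp [colR]
            simp only [Fin.reduceFinMk, this, and_true, ne_eq, not_not]
            exact eq_comm
          unfold domc
          simp only [hS]
          simp
          exact eq_comm
      · have hS : ∀ y, ¬ G.Adj v y ↔ c y = .inr p := by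
          intro y
          rw [hadj, h]
          rcases h' : c y with i | q
          · simp only [colR, and_true, ne_eq, not_not, reduceCtorEq, iff_false]
            rintro rfl
            rw [h] at h'; cases h'
          · simp only [colR, ne_eq, Sum.inr.injEq]
            constructor
            · intro hh
              by_contra hq
              refine hh ⟨?_, fun hh => hq hh.symm⟩
              rintro rfl
              rw [h] at h'; cases h'; exact hq rfl
            · rintro rfl; simp
        unfold domc
        simp only [hS, hfib]
        have : ∀ w, c w = .inr p → ∀ x, G.Adj v x ↔ G.Adj w x := by
          intro w hw x
          have hvx := hS x
          rw [← not_iff_not, hvx, hadj, hw]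
          rcases h' : c x with i | q
          · simp only [colR, and_true, ne_eq, not_not, reduceCtorEq, false_iff]
            rintro rfl
            rw [hw] at h'; cases h'
          · simp only [colR, ne_eq, Sum.inr.injEq]
            constructor
            · rintro rfl; simp
            · intro hh
              by_contra hq
              refine hh ⟨?_, fun hh => hq hh.symm⟩
              rintro rfl
              rw [hw] at h'; cases h'; exact hq rfl
        simp only [colSize]
        constructor
        · rintro ⟨h1, -⟩; exact Or.inr ⟨p, rfl, h1⟩
        · rintro (⟨h1, -⟩ | ⟨q, hq, h1⟩)
          · cases h1
          · cases hq; exact ⟨h1, this⟩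
    have e1 : invD G s = Nat.card {x // (fun a : Fin 3 ⊕ μ.ToType => (a = .inl 2 ∧ s = 1) ∨
        (∃ p : μ.ToType, a = .inr p ∧ p.1 = s)) (c x)} :=
      Nat.card_congr (Equiv.subtypeEquivRight key)
    rw [e1, hc (fun a : Fin 3 ⊕ μ.ToType => (a = .inl 2 ∧ s = 1) ∨
        (∃ p : μ.ToType, a = .inr p ∧ p.1 = s)), Fintype.sum_sum_type]
    have e2 : ∑ p : μ.ToType, (if p.1 = s then p.1 else 0) = s * μ.count s := by
      have : ∑ p : μ.ToType, (if p.1 = s then p.1 else 0)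
          = (μ.map (fun x => if x = s then x else 0)).sum := by
        rw [← Multiset.map_univ μ (fun x => if x = s then x else 0)]
        rfl
      rw [this]
      clear * -
      induction μ using Multiset.induction_on with
      | empty => simp
      | cons a μ ih =>
        rw [Multiset.map_cons, Multiset.sum_cons, ih, Multiset.count_cons]
        by_cases h : a = s
        · subst h; simp; ring
        · simp [h, Ne.symm h]
    rw [← e2, add_comm]
    congr 1
    · refine Finset.sum_congr rfl fun p _ => ?_
      simp [colSize]
    · simp [Fin.sum_univ_three, colSize]

/-- Assignment of invariants (μ, U, T) to a partition p of n. -/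
inductive PCode (n : ℕ) : Multiset ℕ → Multiset ℕ → ℕ → ℕ → Prop
  | c1 (p : Multiset ℕ) (h2 : ∀ x ∈ p, 2 ≤ x) (hc : 2 ≤ p.card) (hs : p.sum = n) : PCode n p p 0 0
  | c2 (q : Multiset ℕ) (j : ℕ) (hj : 3 ≤ j) (h2 : ∀ x ∈ q, 2 ≤ x) (hs : j + q.sum = n) :
      PCode n (Multiset.replicate j 1 + q) q j j
  | c3 (q : Multiset ℕ) (L : ℕ) (hL : 3 ≤ L) (h2 : ∀ x ∈ q, 2 ≤ x) (h0 : q ≠ 0)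
      (hs : 2 + L + q.sum = n) : PCode n (1 ::ₘ (L + 1) ::ₘ q) q 0 L
  | c4 (q : Multiset ℕ) (L : ℕ) (hL : 3 ≤ L) (h2 : ∀ x ∈ q, 2 ≤ x) (h0 : q ≠ 0)
      (hs : 3 + L + q.sum = n) : PCode n (1 ::ₘ 1 ::ₘ (L + 1) ::ₘ q) q 0 L
  | c5 (a b : ℕ) (hs : 1 + 2 * a + 3 * b = n) :
      PCode n (1 ::ₘ (Multiset.replicate a 2 + Multiset.replicate b 3)) 0 3 (6 + b / 2)
  | c6 (a b c : ℕ) (hs : 2 + 2 * a + 3 * b = n) (hc : c + 6 + b / 2 = n) :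
      PCode n (1 ::ₘ 1 ::ₘ (Multiset.replicate a 2 + Multiset.replicate b 3)) {c} 0 (6 + b / 2)
  | c7 (T : ℕ) (hs : T + 2 = n) : PCode n {n} {2} 0 T
  | c8 (c : ℕ) (hs : c + 1 = n) : PCode n (1 ::ₘ {c}) 0 4 7
  | c9 (c d : ℕ) (hs : c + 2 = n) (hd : d + 7 = n) : PCode n (1 ::ₘ 1 ::ₘ {c}) {d} 0 3

theorem PCode.inj {n : ℕ} (hn : 9 ≤ n) {p p' μ : Multiset ℕ} {U T : ℕ}
    (h : PCode n p μ U T) (h' : PCode n p' μ U T) : p = p' := by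
  have aux : ∀ a b c : ℕ, 2 + 2 * a + 3 * b = n → c + 6 + b / 2 = n → c = 2 → False := by
    intro a b c h1 h2 h3
    have h9 : n = 9 := by omega
    have hb : b = 2 := by omega
    omega
  have key : ∀ {p p' μ μ' : Multiset ℕ} {U U' T T' : ℕ}, PCode n p μ U T → PCode n p' μ' U' T' →
      μ = μ' → U = U' → T = T' → p = p' := by
    intro p p' μ μ' U U' T T' h h' e1 e2 e3
    have e4 := congrArg Multiset.sum e1
    cases h <;> cases h' <;> (try simp only [Multiset.sum_singleton, Multiset.sum_zero] at e4) <;>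
      first
      | (exfalso; omega)
      | exact e1
      | (subst e1; subst e2; rfl)
      | (subst e1; subst e3; rfl)
      | rfl
      | skip
    · rename_i a b hs a' b' hs'
      have hb : b = b' := by omega
      have ha : a = a' := by omega
      rw [ha, hb]
    · rename_i a b c hs hc a' b' c' hs' hc'
      have hb : b = b' := by omega
      have ha : a = a' := by omega
      rw [ha, hb]
    · rename_i a b c hs hc hT
      exact (aux a b c hs hc (by omega)).elim
    · rename_i T hT a b c hs hc
      exact (aux a b c hs hc (by omega)).elim
    · rename_i c hs c' hs'
      have : c = c' := by omega
      rw [this]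
    · rename_i c _ hs _ c' _ hs' _
      have : c = c' := by omega
      rw [this]
  exact key h h' rfl rfl rfl

theorem eq_23 (q : Multiset ℕ) (h2 : ∀ x ∈ q, 2 ≤ x) (h3 : ∀ x ∈ q, x ≤ 3) :
    ∃ a b, q = Multiset.replicate a 2 + Multiset.replicate b 3 := by
  induction q using Multiset.induction_on with
  | empty => exact ⟨0, 0, by simp⟩
  | cons x q ih =>
    obtain ⟨a, b, hab⟩ := ih (fun x hx => h2 x (Multiset.mem_cons_of_mem hx))
      (fun x hx => h3 x (Multiset.mem_cons_of_mem hx))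
    have l := h2 x (Multiset.mem_cons_self _ _)
    have u := h3 x (Multiset.mem_cons_self _ _)
    have : x = 2 ∨ x = 3 := by omega
    rcases this with rfl | rfl
    · exact ⟨a + 1, b, by rw [hab, Multiset.replicate_succ, Multiset.cons_add]⟩
    · exact ⟨a, b + 1, by rw [hab, Multiset.replicate_succ, Multiset.add_cons]⟩

/-- Trichotomy for multisets with parts at least two. -/
theorem tri (q : Multiset ℕ) (h2 : ∀ x ∈ q, 2 ≤ x) :
    (∃ a b, q = Multiset.replicate a 2 + Multiset.replicate b 3) ∨ (∃ c, q = {c}) ∨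
    (∃ L r, 3 ≤ L ∧ r ≠ 0 ∧ (∀ x ∈ r, 2 ≤ x) ∧ q = (L + 1) ::ₘ r) := by
  by_cases h : ∀ x ∈ q, x ≤ 3
  · exact Or.inl (eq_23 q h2 h)
  · push Not at h
    obtain ⟨x, hx, h3⟩ := h
    obtain ⟨r, rfl⟩ := Multiset.exists_cons_of_mem hx
    right
    by_cases hr : r = 0
    · left; exact ⟨x, by simp [hr]⟩
    · right
      obtain ⟨L, rfl⟩ : ∃ L, x = L + 1 := ⟨x - 1, by omega⟩
      exact ⟨L, r, by omega, hr, fun y hy => h2 y (Multiset.mem_cons_of_mem hy), rfl⟩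

theorem PCode.exists {n : ℕ} (hn : 9 ≤ n) (p : Multiset ℕ) (hpos : ∀ x ∈ p, 0 < x)
    (hs : p.sum = n) : ∃ μ U T, PCode n p μ U T := by
  obtain ⟨j, q, h2, rfl⟩ : ∃ j q, (∀ x ∈ q, 2 ≤ x) ∧ p = Multiset.replicate j 1 + q := by
    refine ⟨p.count 1, p.filter (fun x => ¬ (x = 1)), ?_, ?_⟩
    · intro x hx
      rw [Multiset.mem_filter] at hx
      have := hpos x hx.1
      omega
    · rw [← Multiset.filter_eq' p 1, Multiset.filter_add_not]
  rw [Multiset.sum_add, Multiset.sum_replicate, smul_eq_mul, mul_one] at hs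
  have hj : j = 0 ∨ j = 1 ∨ j = 2 ∨ 3 ≤ j := by omega
  rcases hj with rfl | rfl | rfl | hj
  · simp only [Multiset.replicate_zero, zero_add] at hs ⊢
    by_cases hc : 2 ≤ q.card
    · exact ⟨_, _, _, .c1 q h2 hc hs⟩
    · have : q.card = 0 ∨ q.card = 1 := by omega
      rcases this with h | h
      · rw [Multiset.card_eq_zero] at h
        subst h; simp at hs; omega
      · obtain ⟨a, rfl⟩ := Multiset.card_eq_one.1 h
        simp at hs; subst hs
        exact ⟨_, _, _, .c7 (a - 2) (by omega)⟩
  · have e : Multiset.replicate 1 1 + q = 1 ::ₘ q := by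
      simp [Multiset.singleton_add]
    rw [e]
    rcases tri q h2 with ⟨a, b, rfl⟩ | ⟨c, rfl⟩ | ⟨L, r, hL, hr, hr2, rfl⟩
    · simp at hs
      exact ⟨_, _, _, .c5 a b (by omega)⟩
    · simp at hs
      exact ⟨_, _, _, .c8 c (by omega)⟩
    · simp at hs
      exact ⟨_, _, _, .c3 r L hL hr2 hr (by omega)⟩
  · have e : Multiset.replicate 2 1 + q = 1 ::ₘ 1 ::ₘ q := by
      simp [Multiset.replicate_succ]
    rw [e]
    rcases tri q h2 with ⟨a, b, rfl⟩ | ⟨c, rfl⟩ | ⟨L, r, hL, hr, hr2, rfl⟩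
    · simp at hs
      exact ⟨_, _, _, .c6 a b (n - 6 - b / 2) (by omega) (by omega)⟩
    · simp at hs
      exact ⟨_, _, _, .c9 c (n - 7) (by omega) (by omega)⟩
    · simp at hs
      exact ⟨_, _, _, .c4 r L hL hr2 hr (by omega)⟩
  · exact ⟨_, _, _, .c2 q j hj h2 hs⟩

theorem PCode.two_le {n : ℕ} (hn : 9 ≤ n) {p μ : Multiset ℕ} {U T : ℕ}
    (h : PCode n p μ U T) : ∀ x ∈ μ, 2 ≤ x := by
  cases h <;> first | assumption | (simp; done) | (simp; omega)

theorem PCode.graph {n : ℕ} (hn : 9 ≤ n) {p μ : Multiset ℕ} {U T : ℕ}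
    (h : PCode n p μ U T) : ∃ G : SimpleGraph (Fin n), IsAnosov G ∧ invT G = T ∧
      ∀ s, invD G s = s * μ.count s + if s = 1 then U else 0 := by
  have main : ∀ (k l m : ℕ) (t : Prop) [Decidable t],
      k + l + m + μ.sum = n → ((k = 0 ∧ l = 0) ∨ (3 ≤ k ∧ 2 ≤ l ∧ (t → 3 ≤ l))) →
      (m = 0 ∨ 3 ≤ m) → (1 ≤ m ∨ (μ ≠ 0 ∧ (1 ≤ k ∨ 2 ≤ μ.card))) →
      m = U → k + m + (if t then l else 0) = T →
      ∃ G : SimpleGraph (Fin n), IsAnosov G ∧ invT G = T ∧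
      ∀ s, invD G s = s * μ.count s + if s = 1 then U else 0 := by
    intro k l m t _ h1 h2 h3 h4 h5 h6
    obtain ⟨G, hG, hT, hD⟩ := realize n k l m t μ h1 h2 h3 (h.two_le hn) h4
    refine ⟨G, hG, hT.trans h6, ?_⟩
    subst h5
    exact hD
  cases h with
  | c1 _ h2 hc hs =>
    refine main 0 0 0 False (by omega) (by omega) (by omega) (Or.inr ⟨?_, Or.inr hc⟩) rfl (by simp)
    rintro rfl
    simp at hc
  | c2 _ _ hj h2 hs =>
    exact main 0 0 U False (by omega) (by omega) (by omega) (Or.inl (by omega)) rfl (by simp)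
  | c3 _ _ hL h2 h0 hs =>
    exact main T 2 0 False (by omega) (by simp; omega) (by omega) (Or.inr ⟨h0, by omega⟩) rfl (by simp)
  | c4 _ _ hL h2 h0 hs =>
    exact main T 3 0 False (by omega) (by simp; omega) (by omega) (Or.inr ⟨h0, by omega⟩) rfl (by simp)
  | c5 a b hs =>
    exact main (3 + b / 2) (n - 6 - b / 2) 3 False (by simp; omega) (by simp; omega) (by omega)
      (Or.inl (by omega)) rfl (by simp; omega)
  | c6 a b c hs hc =>
    exact main (3 + b / 2) 3 0 True (by simp; omega) (by simp) (by omega)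
      (Or.inr ⟨by simp, by omega⟩) rfl (by simp; omega)
  | c7 _ hs =>
    exact main (n - 5) 3 0 True (by simp; omega) (by simp; omega) (by omega)
      (Or.inr ⟨by simp, by omega⟩) rfl (by simp; omega)
  | c8 c hs =>
    exact main 3 (n - 7) 4 False (by simp; omega) (by simp; omega) (by omega)
      (Or.inl (by omega)) rfl (by simp)
  | c9 c d hs hd =>
    exact main 3 4 0 False (by simp; omega) (by simp) (by omega)
      (Or.inr ⟨by simp, by omega⟩) rfl (by simp)

/-- For `n ≥ 9`, the number `p(n)` of partitions of `n` is at most the number `a(n)` of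
isomorphism classes of Anosov graphs on `n` vertices. -/
theorem partitionCount_le_anosovCount (n : ℕ) (hn : 9 ≤ n) :
    Fintype.card (Nat.Partition n) ≤ anosovCount n := by
  have hex : ∀ q : Nat.Partition n, ∃ μ U T, PCode n q.parts μ U T := fun q =>
    PCode.exists hn q.parts (fun x hx => q.parts_pos hx) q.parts_sum
  choose μ U T hc using hex
  choose G hA hT hD using fun q => (hc q).graph hn
  rw [← Nat.card_eq_fintype_card]
  unfold anosovCount
  refine Nat.card_le_card_of_injective
    (fun q => (Quotient.mk (graphClassSetoid n IsAnosov) ⟨G q, hA q⟩)) ?_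
  intro q r hqr
  obtain ⟨e⟩ : Nonempty (G q ≃g G r) := Quotient.exact hqr
  have eT : T q = T r := by rw [← hT q, ← hT r]; exact invT_iso e
  have eD : ∀ s, s * (μ q).count s + (if s = 1 then U q else 0)
      = s * (μ r).count s + (if s = 1 then U r else 0) := by
    intro s
    rw [← hD q, ← hD r]
    exact invD_iso e s
  have h0 : ∀ q s, s < 2 → (μ q).count s = 0 := by
    intro q s hs
    rw [Multiset.count_eq_zero]
    intro hm
    have := (hc q).two_le hn s hm
    omega
  have eU : U q = U r := by
    have := eD 1
    simpa [h0] using this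
  have eμ : μ q = μ r := by
    ext s
    by_cases hs : s < 2
    · rw [h0 q s hs, h0 r s hs]
    · have := eD s
      rw [if_neg (by omega), if_neg (by omega), add_zero, add_zero] at this
      exact Nat.eq_of_mul_eq_mul_left (by omega) this
  have h1 := hc q
  rw [eT, eU, eμ] at h1
  exact Nat.Partition.ext (PCode.inj hn h1 (hc r))
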